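/- There exists a universal constant c > 0 with the following property. Let K ⊂ ℝⁿ be a centrally symmetric convex body of volume 1 which is 2-convex with constant α > 0, and suppose K is isotropic with isotropic constant L_K. Then c·√α·√n·L_K·D_n ⊆ K, where D_n is the Euclidean unit ball of ℝⁿ. -/

import Mathlib

open MeasureTheory
open scoped RealInnerProductSpace

noncomputable section

/-- A centrally symmetric convex body: compact, convex, with nonempty interior,
and symmetric about the origin. -/
def IsSymmConvexBody {E : Type*} [NormedAddCommGroup E] [NormedSpace ℝ E]
    (K : Set E) : Prop :=
  IsCompact K ∧ Convex ℝ K ∧ (interior K).Nonempty ∧ K = -K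

/-- The modulus of convexity of `K`, defined via the gauge (Minkowski functional) of `K`. -/
def modulusOfConvexity {E : Type*} [AddCommGroup E] [Module ℝ E]
    (K : Set E) (ε : ℝ) : ℝ :=
  sInf { d | ∃ x y : E, gauge K x ≤ 1 ∧ gauge K y ≤ 1 ∧ ε ≤ gauge K (x - y) ∧
    d = 1 - gauge K ((2:ℝ)⁻¹ • (x + y)) }

/-- `K` is 2-convex with constant `α`: `δ_K(ε) ≥ α ε²` for all `0 < ε ≤ 2`. -/
def IsTwoConvex {E : Type*} [AddCommGroup E] [Module ℝ E]
    (K : Set E) (α : ℝ) : Prop :=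
  ∀ ε : ℝ, 0 < ε → ε ≤ 2 → α * ε ^ 2 ≤ modulusOfConvexity K ε

/-- `K` (of volume 1) is isotropic with isotropic constant `L`:
`∫_K ⟨x,θ⟩² dx = L² |θ|²` for every `θ`. -/
def IsIsotropic {n : ℕ} (K : Set (EuclideanSpace ℝ (Fin n))) (L : ℝ) : Prop :=
  0 < L ∧ ∀ θ : EuclideanSpace ℝ (Fin n),
    ∫ x in K, ⟪x, θ⟫ ^ 2 = L ^ 2 * ‖θ‖ ^ 2

open scoped ENNReal Pointwise

/-- One-dimensional Brunn–Minkowski for compact sets, in midpoint form. -/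
theorem IsCompact.volume_add_volume_le_of_midpoint_mem {A B C : Set ℝ} (hA : IsCompact A)
    (hB : IsCompact B) (hA' : A.Nonempty) (hB' : B.Nonempty)
    (h : ∀ x ∈ A, ∀ y ∈ B, (2 : ℝ)⁻¹ • (x + y) ∈ C) :
    volume A + volume B ≤ 2 * volume C := by
  set D : Set ℝ := (fun x => (2 : ℝ)⁻¹ * x) ⁻¹' C with hD
  have hDC : volume D = 2 * volume C := by
    rw [hD, Real.volume_preimage_mul_left (by norm_num)]
    norm_num
  set a := sSup A
  set b := sInf B
  have ha : a ∈ A := hA.sSup_mem hA'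
  have hb : b ∈ B := hB.sInf_mem hB'
  have h1 : volume A ≤ volume (D ∩ Set.Iic (a + b)) := by
    rw [← measure_preimage_add_right volume (-b) A]
    refine measure_mono fun x hx => ⟨?_, ?_⟩
    · have := h _ hx _ hb
      simpa [hD] using this
    · have := le_csSup hA.bddAbove hx
      simp only [Set.mem_Iic]
      linarith
  have h2 : volume B ≤ volume (D ∩ Set.Ioi (a + b)) := by
    have : volume (D ∩ Set.Ioi (a + b)) = volume (D ∩ Set.Ici (a + b)) :=
      measure_congr (Filter.EventuallyEq.rfl.inter Ioi_ae_eq_Ici)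
    rw [this, ← measure_preimage_add volume (-a) B]
    refine measure_mono fun x hx => ⟨?_, ?_⟩
    · have := h _ ha _ hx
      simpa [hD] using this
    · have := csInf_le hB.bddBelow hx
      simp only [Set.mem_Ici]
      linarith
  rw [← hDC, ← measure_inter_add_sdiff D (measurableSet_Iic (a := a + b))]
  refine add_le_add h1 (h2.trans (measure_mono fun x hx => ⟨hx.1, fun hx' => (Set.mem_Ioi.1 hx.2).not_ge (Set.mem_Iic.1 hx')⟩))

/-- One-dimensional Brunn–Minkowski for measurable sets, in midpoint form. -/
theorem MeasurableSet.volume_add_volume_le_of_midpoint_mem {A B C : Set ℝ} (hA : MeasurableSet A)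
    (hB : MeasurableSet B) (hA' : A.Nonempty) (hB' : B.Nonempty)
    (h : ∀ x ∈ A, ∀ y ∈ B, (2 : ℝ)⁻¹ • (x + y) ∈ C) :
    volume A + volume B ≤ 2 * volume C := by
  obtain ⟨a, ha⟩ := hA'
  obtain ⟨b, hb⟩ := hB'
  refine le_of_forall_lt fun r hr => ?_
  obtain ⟨p, hp, q, hq, hpq⟩ : ∃ p, (p < volume A ∨ p = 0) ∧ ∃ q, (q < volume B ∨ q = 0) ∧
      r < p + q := by
    by_cases hA0 : volume A = 0
    · rw [hA0, zero_add] at hr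
      obtain ⟨q, hq⟩ := exists_between hr
      exact ⟨0, Or.inr rfl, q, Or.inl hq.2, by simpa using hq.1⟩
    by_cases hB0 : volume B = 0
    · rw [hB0, add_zero] at hr
      obtain ⟨q, hq⟩ := exists_between hr
      exact ⟨q, Or.inl hq.2, 0, Or.inr rfl, by simpa using hq.1⟩
    obtain ⟨p, hp, q, hq, hpq⟩ := ENNReal.exists_lt_add_of_lt_add hr hA0 hB0
    exact ⟨p, Or.inl hp, q, Or.inl hq, hpq⟩
  have key : ∀ (S : Set ℝ) (s : ℝ), MeasurableSet S → s ∈ S → ∀ p, (p < volume S ∨ p = 0) →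
      ∃ K ⊆ S, IsCompact K ∧ K.Nonempty ∧ p ≤ volume K := by
    rintro S s hS hs p (hp | rfl)
    · obtain ⟨K, hK, hKc, hpK⟩ := hS.exists_lt_isCompact hp
      exact ⟨insert s K, Set.insert_subset hs hK, hKc.insert s, Set.insert_nonempty _ _,
        hpK.le.trans (measure_mono (Set.subset_insert _ _))⟩
    · exact ⟨{s}, by simpa, isCompact_singleton, Set.singleton_nonempty _, zero_le⟩
  obtain ⟨K, hK, hKc, hKn, hpK⟩ := key A a hA ha p hp
  obtain ⟨L, hL, hLc, hLn, hqL⟩ := key B b hB hb q hq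
  exact hpq.trans_le ((add_le_add hpK hqL).trans
    (hKc.volume_add_volume_le_of_midpoint_mem hLc hKn hLn
      fun x hx y hy => h x (hK hx) y (hL hy)))

/-- The layer cake formula for functions bounded by one. -/
theorem lintegral_eq_lintegral_meas_ofReal_lt {f : ℝ → ℝ≥0∞} (hf : Measurable f)
    (hf1 : ∀ x, f x ≤ 1) :
    ∫⁻ x, f x = ∫⁻ t in Set.Ioi (0 : ℝ), volume {x | ENNReal.ofReal t < f x} := by
  have hfin : ∀ x, f x ≠ ∞ := fun x => ((hf1 x).trans_lt ENNReal.one_lt_top).ne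
  have := lintegral_eq_lintegral_meas_lt (volume : Measure ℝ) (f := fun x => (f x).toReal)
    (Filter.Eventually.of_forall fun _ => ENNReal.toReal_nonneg) hf.ennreal_toReal.aemeasurable
  simp only [ENNReal.ofReal_toReal (hfin _)] at this
  rw [this]
  refine setLIntegral_congr_fun measurableSet_Ioi fun t ht => ?_
  congr 1
  ext x
  exact (ENNReal.ofReal_lt_iff_lt_toReal (le_of_lt ht) (hfin x)).symm

/-- A one-dimensional functional inequality for functions with supremum one. -/
theorem lintegral_add_le_of_mul_le_sq {f g h : ℝ → ℝ≥0∞} (hf : Measurable f)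
    (hg : Measurable g) (hh : Measurable h) (hf1 : ∀ x, f x ≤ 1) (hg1 : ∀ x, g x ≤ 1)
    (hf' : ∀ t < 1, ∃ x, t < f x) (hg' : ∀ t < 1, ∃ x, t < g x)
    (hfg : ∀ x y, f x * g y ≤ h ((2 : ℝ)⁻¹ • (x + y)) ^ 2) :
    (∫⁻ x, f x) + (∫⁻ x, g x) ≤ 2 * ∫⁻ x, h x := by
  have hmin : ∫⁻ x, min (h x) 1 ≤ ∫⁻ x, h x := lintegral_mono fun x => min_le_left _ _
  refine le_trans ?_ (mul_le_mul_right hmin 2)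
  have hm : Measurable fun x => min (h x) 1 := hh.min measurable_const
  rw [lintegral_eq_lintegral_meas_ofReal_lt hf hf1, lintegral_eq_lintegral_meas_ofReal_lt hg hg1,
    lintegral_eq_lintegral_meas_ofReal_lt hm fun x => min_le_right _ _]
  have anti : ∀ φ : ℝ → ℝ≥0∞, Measurable fun t : ℝ => volume {x | ENNReal.ofReal t < φ x} :=
    fun φ => Antitone.measurable fun s t hst => measure_mono fun x hx =>
      (ENNReal.ofReal_le_ofReal hst).trans_lt hx
  rw [← lintegral_add_left (anti f), ← lintegral_const_mul _ (anti _)]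
  refine setLIntegral_mono ((anti _).const_mul 2) fun t ht => ?_
  rcases lt_or_ge (ENNReal.ofReal t) 1 with h1 | h1
  · refine MeasurableSet.volume_add_volume_le_of_midpoint_mem
      (measurableSet_lt measurable_const hf) (measurableSet_lt measurable_const hg)
      (hf' _ h1) (hg' _ h1) fun x hx y hy => lt_min ?_ h1
    have h2 : ENNReal.ofReal t ^ 2 < h ((2 : ℝ)⁻¹ • (x + y)) ^ 2 := by
      refine lt_of_lt_of_le ?_ (hfg x y)
      rw [sq]
      exact ENNReal.mul_lt_mul hx hy
    exact lt_of_not_ge fun h3 => h2.not_ge (pow_le_pow_left' h3 2)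
  · have e : ∀ φ : ℝ → ℝ≥0∞, (∀ x, φ x ≤ 1) → {x | ENNReal.ofReal t < φ x} = ∅ := fun φ hφ =>
      Set.eq_empty_of_forall_notMem fun x hx => absurd (lt_of_lt_of_le hx (hφ x)) h1.not_gt
    simp [e f hf1, e g hg1]

/-- The midpoint form of the Prékopa–Leindler inequality for a measure `μ`. -/
def MidpointPrekopaLeindler {E : Type*} [AddCommGroup E] [Module ℝ E] [MeasurableSpace E]
    (μ : Measure E) : Prop :=
  ∀ f g h : E → ℝ≥0∞, Measurable f → Measurable g → Measurable h →
    (∀ x y, f x * g y ≤ h ((2 : ℝ)⁻¹ • (x + y)) ^ 2) →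
    (∫⁻ x, f x ∂μ) * (∫⁻ x, g x ∂μ) ≤ (∫⁻ x, h x ∂μ) ^ 2

theorem ENNReal.mul_le_sq_of_add_le {a b c : ℝ≥0∞} (h : a + b ≤ 2 * c) : a * b ≤ c ^ 2 := by
  rcases eq_or_ne c ∞ with rfl | hc
  · simp
  have hab : a + b ≠ ∞ := (h.trans_lt (ENNReal.mul_lt_top (by simp) hc.lt_top)).ne
  obtain ⟨ha, hb⟩ := ENNReal.add_ne_top.1 hab
  lift a to NNReal using ha
  lift b to NNReal using hb
  lift c to NNReal using hc
  norm_cast at h ⊢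
  rw [← NNReal.coe_le_coe] at h ⊢
  push_cast at h ⊢
  nlinarith [sq_nonneg ((a : ℝ) - b), a.coe_nonneg, b.coe_nonneg, c.coe_nonneg]

/-- The one-dimensional Prékopa–Leindler inequality for bounded functions. -/
theorem lintegral_mul_lintegral_le_sq_of_bounded {f g h : ℝ → ℝ≥0∞} (hf : Measurable f)
    (hg : Measurable g) (hh : Measurable h) (hfb : ⨆ x, f x ≠ ∞) (hgb : ⨆ x, g x ≠ ∞)
    (hfg : ∀ x y, f x * g y ≤ h ((2 : ℝ)⁻¹ • (x + y)) ^ 2) :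
    (∫⁻ x, f x) * (∫⁻ x, g x) ≤ (∫⁻ x, h x) ^ 2 := by
  set M := ⨆ x, f x with hM
  set N := ⨆ x, g x with hN
  rcases eq_or_ne M 0 with hM0 | hM0
  · have : f = 0 := funext fun x => le_antisymm ((le_iSup f x).trans hM0.le) zero_le
    simp [this]
  rcases eq_or_ne N 0 with hN0 | hN0
  · have : g = 0 := funext fun x => le_antisymm ((le_iSup g x).trans hN0.le) zero_le
    simp [this]
  have exS : ∃ S : ℝ≥0∞, S ^ 2 = M * N := ⟨(M * N) ^ (1 / 2 : ℝ), by
    rw [← ENNReal.rpow_natCast, ← ENNReal.rpow_mul]; norm_num⟩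
  obtain ⟨S, hS⟩ := exS
  have hinv : M⁻¹ * N⁻¹ = S⁻¹ ^ 2 := by
    rw [← ENNReal.mul_inv (Or.inl hM0) (Or.inl hfb), ← hS, ENNReal.inv_pow]
  have hS0 : S ^ 2 ≠ 0 := by rw [hS]; exact mul_ne_zero hM0 hN0
  have hSt : S ^ 2 ≠ ∞ := by rw [hS]; exact ENNReal.mul_ne_top hfb hgb
  have sup : ∀ (φ : ℝ → ℝ≥0∞), ⨆ x, φ x ≠ 0 → ⨆ x, φ x ≠ ∞ →
      ∀ t < 1, ∃ x, t < (⨆ x, φ x)⁻¹ * φ x := by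
    intro φ h0 ht t h1
    have : t * (⨆ x, φ x) < ⨆ x, φ x := by
      simpa using (ENNReal.mul_lt_mul_iff_left h0 ht).2 h1
    obtain ⟨x, hx⟩ := lt_iSup_iff.1 this
    refine ⟨x, ?_⟩
    rw [mul_comm, ← div_eq_mul_inv]
    exact (ENNReal.lt_div_iff_mul_lt (Or.inl h0) (Or.inl ht)).2 hx
  have bd : ∀ (φ : ℝ → ℝ≥0∞), ∀ x, (⨆ x, φ x)⁻¹ * φ x ≤ 1 := by
    intro φ x
    rw [mul_comm, ← div_eq_mul_inv]
    exact ENNReal.div_le_of_le_mul (by simpa using le_iSup φ x)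
  have key := lintegral_add_le_of_mul_le_sq (hf.const_mul M⁻¹) (hg.const_mul N⁻¹)
    (hh.const_mul S⁻¹) (bd f) (bd g) (sup f hM0 hfb) (sup g hN0 hgb) (fun x y => by
      rw [mul_mul_mul_comm, hinv, mul_pow]
      exact mul_le_mul_right (hfg x y) _)
  have key2 := ENNReal.mul_le_sq_of_add_le key
  rw [lintegral_const_mul _ hf, lintegral_const_mul _ hg, lintegral_const_mul _ hh,
    mul_mul_mul_comm, hinv, mul_pow, ← ENNReal.inv_pow] at key2
  exact (ENNReal.mul_le_mul_iff_right (ENNReal.inv_ne_zero.2 hSt) (ENNReal.inv_ne_top.2 hS0)).1 key2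

theorem midpointPrekopaLeindler_real : MidpointPrekopaLeindler (volume : Measure ℝ) := by
  intro f g h hf hg hh hfg
  have trunc : ∀ φ : ℝ → ℝ≥0∞, Measurable φ →
      ∫⁻ x, φ x = ⨆ n : ℕ, ∫⁻ x, min (φ x) n := by
    intro φ hφ
    rw [← lintegral_iSup (fun n => hφ.min measurable_const)
      (fun m n hmn x => min_le_min_left _ (by exact_mod_cast hmn))]
    refine lintegral_congr fun x => ?_
    rw [← inf_iSup_eq, ENNReal.iSup_natCast, inf_top_eq]
  rw [trunc f hf, trunc g hg, ENNReal.iSup_mul]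
  refine iSup_le fun m => ?_
  rw [ENNReal.mul_iSup]
  refine iSup_le fun n => ?_
  refine lintegral_mul_lintegral_le_sq_of_bounded (hf.min measurable_const)
    (hg.min measurable_const) hh ?_ ?_ fun x y =>
      (mul_le_mul' (min_le_left _ _) (min_le_left _ _)).trans (hfg x y)
  · exact ((iSup_le fun x => min_le_right _ _).trans_lt (ENNReal.natCast_lt_top m)).ne
  · exact ((iSup_le fun x => min_le_right _ _).trans_lt (ENNReal.natCast_lt_top n)).ne

namespace MidpointPrekopaLeindler

variable {E F : Type*} [AddCommGroup E] [Module ℝ E] [MeasurableSpace E]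
  [AddCommGroup F] [Module ℝ F] [MeasurableSpace F]

theorem prod {μ : Measure E} {ν : Measure F} [SFinite ν]
    (hμ : MidpointPrekopaLeindler μ) (hν : MidpointPrekopaLeindler ν) :
    MidpointPrekopaLeindler (μ.prod ν) := by
  intro f g h hf hg hh hfg
  rw [lintegral_prod _ hf.aemeasurable, lintegral_prod _ hg.aemeasurable,
    lintegral_prod _ hh.aemeasurable]
  refine hμ _ _ _ hf.lintegral_prod_right' hg.lintegral_prod_right' hh.lintegral_prod_right'
    fun x y => ?_
  exact hν _ _ _ (hf.comp measurable_prodMk_left) (hg.comp measurable_prodMk_left)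
    (hh.comp measurable_prodMk_left) fun x' y' => hfg (x, x') (y, y')

theorem of_measurePreserving {μ : Measure E} {ν : Measure F} (hμ : MidpointPrekopaLeindler μ)
    (e : E →ₗ[ℝ] F) (he : MeasurePreserving e μ ν) : MidpointPrekopaLeindler ν := by
  intro f g h hf hg hh hfg
  rw [← he.lintegral_comp hf, ← he.lintegral_comp hg, ← he.lintegral_comp hh]
  refine hμ _ _ _ (hf.comp he.measurable) (hg.comp he.measurable) (hh.comp he.measurable)
    fun x y => ?_
  simpa using hfg (e x) (e y)

theorem pi (n : ℕ) : MidpointPrekopaLeindler (volume : Measure (Fin n → ℝ)) := by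
  induction n with
  | zero =>
    intro f g h hf hg hh hfg
    rw [Measure.volume_pi_eq_dirac (0 : Fin 0 → ℝ), lintegral_dirac, lintegral_dirac, lintegral_dirac]
    simpa using hfg 0 0
  | succ n ih =>
    refine (midpointPrekopaLeindler_real.prod ih).of_measurePreserving
      (Fin.consLinearEquiv ℝ (fun _ : Fin (n + 1) => ℝ)).toLinearMap ?_
    have := (volume_preserving_piFinSuccAbove (fun _ : Fin (n + 1) => ℝ) 0).symm
    have e : ⇑(Fin.consLinearEquiv ℝ (fun _ : Fin (n + 1) => ℝ)).toLinearMap =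
        ⇑(MeasurableEquiv.piFinSuccAbove (fun _ : Fin (n + 1) => ℝ) 0).symm := by
      funext x i
      refine Fin.cases ?_ (fun j => ?_) i <;> simp [MeasurableEquiv.piFinSuccAbove,
        Fin.consLinearEquiv]
    rw [e]
    exact this

theorem euclideanSpace (n : ℕ) :
    MidpointPrekopaLeindler (volume : Measure (EuclideanSpace ℝ (Fin n))) :=
  (pi n).of_measurePreserving (WithLp.linearEquiv 2 ℝ (Fin n → ℝ)).symm.toLinearMap
    (PiLp.volume_preserving_toLp (Fin n))

/-- The multiplicative Brunn–Minkowski inequality for midpoints. -/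
theorem measure_mul_measure_le_sq {μ : Measure E} (hμ : MidpointPrekopaLeindler μ)
    {A B C : Set E} (hA : MeasurableSet A) (hB : MeasurableSet B) (hC : MeasurableSet C)
    (h : ∀ x ∈ A, ∀ y ∈ B, (2 : ℝ)⁻¹ • (x + y) ∈ C) : μ A * μ B ≤ μ C ^ 2 := by
  have := hμ (A.indicator 1) (B.indicator 1) (C.indicator 1) (measurable_one.indicator hA)
    (measurable_one.indicator hB) (measurable_one.indicator hC) fun x y => by
      by_cases hx : x ∈ A
      · by_cases hy : y ∈ B
        · simp [hx, hy, Set.indicator_of_mem (h x hx y hy), -smul_add]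
        · simp [hy]
      · simp [hx]
  simpa [lintegral_indicator_one, hA, hB, hC] using this

end MidpointPrekopaLeindler

theorem IsSymmConvexBody.mem_nhds_zero {E : Type*} [NormedAddCommGroup E] [NormedSpace ℝ E]
    {K : Set E} (hK : IsSymmConvexBody K) : K ∈ nhds 0 := by
  obtain ⟨-, hconv, ⟨x, hx⟩, hsymm⟩ := hK
  have hneg : -x ∈ K := by
    rw [hsymm]
    simpa using interior_subset hx
  have := hconv.combo_interior_self_mem_interior hx hneg (a := 2⁻¹) (b := 2⁻¹)
    (by norm_num) (by norm_num) (by norm_num)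
  rw [smul_neg, add_neg_cancel] at this
  exact mem_interior_iff_mem_nhds.1 this

theorem IsTwoConvex.gauge_midpoint_le {E : Type*} [NormedAddCommGroup E] [NormedSpace ℝ E]
    {K : Set E} {α ε : ℝ} (hconv : Convex ℝ K) (h0 : K ∈ nhds 0) (h : IsTwoConvex K α)
    (hε : 0 < ε) (hε2 : ε ≤ 2) {x y : E} (hx : x ∈ K) (hy : y ∈ K) (hxy : ε ≤ gauge K (x - y)) :
    gauge K ((2 : ℝ)⁻¹ • (x + y)) ≤ 1 - α * ε ^ 2 := by
  have hle := h ε hε hε2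
  have hinf : modulusOfConvexity K ε ≤ 1 - gauge K ((2 : ℝ)⁻¹ • (x + y)) := by
    refine csInf_le ⟨0, ?_⟩ ⟨x, y, gauge_le_one_of_mem hx, gauge_le_one_of_mem hy, hxy, rfl⟩
    rintro _ ⟨a, b, ha, hb, -, rfl⟩
    have h1 := gauge_add_le hconv (absorbent_nhds_zero h0) a b
    rw [gauge_smul_of_nonneg (by norm_num), smul_eq_mul]
    linarith
  linarith

/-- A linear functional bounded above by `u` on `K` is at most `u` times the gauge. -/
theorem div_le_gauge_of_le_inner {E : Type*} [NormedAddCommGroup E] [InnerProductSpace ℝ E]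
    {K : Set E} (h0 : K ∈ nhds 0) {θ : E} {u s : ℝ} (hu : 0 < u) (hθ : ∀ x ∈ K, ⟪x, θ⟫ ≤ u)
    {z : E} (hz : s ≤ ⟪z, θ⟫) : s / u ≤ gauge K z := by
  by_contra! hlt
  obtain ⟨b, hb, hbs, x, hx, rfl⟩ := exists_lt_of_gauge_lt (absorbent_nhds_zero h0) hlt
  simp only [real_inner_smul_left] at hz
  have h1 := mul_le_mul_of_nonneg_left (hθ x hx) hb.le
  rw [lt_div_iff₀ hu] at hbs
  linarith

section Euclidean

variable {n : ℕ} {K : Set (EuclideanSpace ℝ (Fin n))} {α u : ℝ} {θ : EuclideanSpace ℝ (Fin n)}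

theorem IsSymmConvexBody.one_le_two_mul_volume_halfspace (hK : IsSymmConvexBody K)
    (hvol : volume K = 1) : 1 ≤ 2 * volume {x | x ∈ K ∧ ⟪x, θ⟫ ≤ 0} := by
  set B := {x | x ∈ K ∧ ⟪x, θ⟫ ≤ 0}
  have hsub : K ⊆ B ∪ -B := by
    intro x hx
    rcases le_total ⟪x, θ⟫ 0 with h | h
    · exact Or.inl ⟨hx, h⟩
    · refine Or.inr ⟨?_, by simpa using h⟩
      rw [hK.2.2.2]
      simpa using hx
  calc 1 = volume K := hvol.symm
    _ ≤ volume (B ∪ -B) := measure_mono hsub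
    _ ≤ volume B + volume (-B) := measure_union_le _ _
    _ = 2 * volume B := by rw [Measure.measure_neg, two_mul]

/-- One-sided deviation inequality for linear functionals on a 2-convex body. -/
theorem IsTwoConvex.volume_lt_inner_le (hK : IsSymmConvexBody K) (hvol : volume K = 1)
    (hα : IsTwoConvex K α) (hu : 0 < u) (hθ : ∀ x ∈ K, ⟪x, θ⟫ ≤ u) {s : ℝ} (hs : 0 < s) :
    volume {x | x ∈ K ∧ s < ⟪x, θ⟫} ≤
      2 * ENNReal.ofReal (Real.exp (-(2 * n * α / u ^ 2) * s ^ 2)) := by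
  have h0 := hK.mem_nhds_zero
  have hcl : IsClosed K := hK.1.isClosed
  rcases lt_or_ge u s with hus | hsu
  · have : {x | x ∈ K ∧ s < ⟪x, θ⟫} = ∅ :=
      Set.eq_empty_of_forall_notMem fun x hx => by linarith [hθ x hx.1, hx.2]
    simp [this]
  set A := {x | x ∈ K ∧ s < ⟪x, θ⟫}
  set B := {x | x ∈ K ∧ ⟪x, θ⟫ ≤ 0}
  set r := Real.exp (-(α * (s / u) ^ 2)) with hr
  have hr0 : 0 < r := Real.exp_pos _
  have hcont : Continuous fun x : EuclideanSpace ℝ (Fin n) => ⟪x, θ⟫ := by fun_prop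
  have hA : MeasurableSet A :=
    hcl.measurableSet.inter (measurableSet_lt measurable_const hcont.measurable)
  have hB : MeasurableSet B :=
    hcl.measurableSet.inter (measurableSet_le hcont.measurable measurable_const)
  have hC : MeasurableSet (r • K) := hcl.measurableSet.const_smul₀ r
  have hmid : ∀ x ∈ A, ∀ y ∈ B, (2 : ℝ)⁻¹ • (x + y) ∈ r • K := by
    intro x hx y hy
    have hg : s / u ≤ gauge K (x - y) := div_le_gauge_of_le_inner h0 hu hθ (by
      rw [inner_sub_left]
      linarith [hx.2, hy.2])
    have hsu1 : s / u ≤ 1 := (div_le_one hu).2 hsu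
    have h1 := hα.gauge_midpoint_le hK.2.1 h0 (div_pos hs hu) (by linarith) hx.1 hy.1 hg
    have h2 : gauge K ((2 : ℝ)⁻¹ • (x + y)) ≤ r := by
      have := Real.add_one_le_exp (-(α * (s / u) ^ 2))
      linarith
    rw [Set.mem_smul_set_iff_inv_smul_mem₀ hr0.ne', ← hcl.closure_eq,
      ← gauge_le_one_iff_mem_closure hK.2.1 h0, gauge_smul_of_nonneg (by positivity), smul_eq_mul,
      inv_mul_le_iff₀ hr0, mul_one]
    exact h2
  have hBM := (MidpointPrekopaLeindler.euclideanSpace n).measure_mul_measure_le_sq hA hB hC hmid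
  have hCvol : volume (r • K) ^ 2 = ENNReal.ofReal (Real.exp (-(2 * n * α / u ^ 2) * s ^ 2)) := by
    rw [Measure.addHaar_smul, hvol, mul_one, finrank_euclideanSpace_fin,
      abs_of_pos (by positivity), ← ENNReal.ofReal_pow (by positivity), ← pow_mul, hr,
      ← Real.exp_nat_mul]
    congr 2
    push_cast
    field_simp
  calc volume A = volume A * 1 := (mul_one _).symm
    _ ≤ volume A * (2 * volume B) := by
      gcongr
      exact hK.one_le_two_mul_volume_halfspace hvol
    _ = 2 * (volume A * volume B) := by ring
    _ ≤ _ := by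
      rw [← hCvol]
      gcongr

theorem IsTwoConvex.volume_lt_inner_sq_le (hK : IsSymmConvexBody K) (hvol : volume K = 1)
    (hα : IsTwoConvex K α) (hu : 0 < u) (hθ : ∀ x ∈ K, ⟪x, θ⟫ ≤ u) {t : ℝ} (ht : 0 < t) :
    volume.restrict K {x | t < ⟪x, θ⟫ ^ 2} ≤
      ENNReal.ofReal (4 * Real.exp (-(2 * n * α / u ^ 2) * t)) := by
  set s := √t with hs
  have hst : s ^ 2 = t := Real.sq_sqrt ht.le
  have hdev := hα.volume_lt_inner_le hK hvol hu hθ (Real.sqrt_pos.2 ht)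
  rw [← hs, hst] at hdev
  set A := {x | x ∈ K ∧ s < ⟪x, θ⟫}
  have hcont : Continuous fun x : EuclideanSpace ℝ (Fin n) => ⟪x, θ⟫ ^ 2 := by fun_prop
  rw [Measure.restrict_apply (measurableSet_lt measurable_const hcont.measurable)]
  have hsub : {x | t < ⟪x, θ⟫ ^ 2} ∩ K ⊆ A ∪ -A := by
    rintro x ⟨hx, hxK⟩
    have h1 : s < |⟪x, θ⟫| := by
      rw [← Real.sqrt_sq_eq_abs]
      exact Real.sqrt_lt_sqrt ht.le hx
    rcases lt_abs.1 h1 with h | h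
    · exact Or.inl ⟨hxK, h⟩
    · refine Or.inr ⟨?_, by simpa using h⟩
      rw [hK.2.2.2]
      simpa using hxK
  calc _ ≤ volume (A ∪ -A) := measure_mono hsub
    _ ≤ volume A + volume (-A) := measure_union_le _ _
    _ = 2 * volume A := by rw [Measure.measure_neg, two_mul]
    _ ≤ 2 * (2 * ENNReal.ofReal (Real.exp (-(2 * n * α / u ^ 2) * t))) := by gcongr
    _ = _ := by
      rw [ENNReal.ofReal_mul (by norm_num), ← mul_assoc]
      norm_num

/-- The second moment of a linear functional on a 2-convex body of volume one is controlled by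
its maximum. -/
theorem IsTwoConvex.setIntegral_inner_sq_le (hn : 0 < n) (hK : IsSymmConvexBody K)
    (hvol : volume K = 1) (hα0 : 0 < α) (hα : IsTwoConvex K α) (hu : 0 < u)
    (hθ : ∀ x ∈ K, ⟪x, θ⟫ ≤ u) :
    ∫ x in K, ⟪x, θ⟫ ^ 2 ≤ 2 * u ^ 2 / (n * α) := by
  have hn' : (0 : ℝ) < n := Nat.cast_pos.2 hn
  set b := 2 * n * α / u ^ 2 with hb
  have hb0 : 0 < b := by positivity
  have hcont : Continuous fun x : EuclideanSpace ℝ (Fin n) => ⟪x, θ⟫ ^ 2 := by fun_prop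
  rw [integral_eq_lintegral_of_nonneg_ae (Filter.Eventually.of_forall fun x => sq_nonneg _)
    hcont.aestronglyMeasurable]
  refine ENNReal.toReal_le_of_le_ofReal (by positivity) ?_
  rw [lintegral_eq_lintegral_meas_lt _ (Filter.Eventually.of_forall fun x => sq_nonneg _)
    hcont.aemeasurable]
  have hint : IntegrableOn (fun t => 4 * Real.exp (-b * t)) (Set.Ioi 0) :=
    (integrableOn_exp_mul_Ioi (neg_lt_zero.2 hb0) 0).const_mul 4
  calc _ ≤ ∫⁻ t in Set.Ioi (0 : ℝ), ENNReal.ofReal (4 * Real.exp (-b * t)) :=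
        setLIntegral_mono (by fun_prop) fun t ht => hα.volume_lt_inner_sq_le hK hvol hu hθ ht
    _ = ENNReal.ofReal (∫ t in Set.Ioi (0 : ℝ), 4 * Real.exp (-b * t)) :=
        (ofReal_integral_eq_lintegral_ofReal hint
          (Filter.Eventually.of_forall fun t => by positivity)).symm
    _ = ENNReal.ofReal (2 * u ^ 2 / (n * α)) := by
        rw [integral_const_mul, integral_exp_mul_Ioi (neg_lt_zero.2 hb0), hb]
        congr 1
        simp only [mul_zero, Real.exp_zero]
        field_simp
        norm_num

end Euclidean

theorem isotropic_twoConvex_contains_ball :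
    ∃ c : ℝ, 0 < c ∧ ∀ (n : ℕ) (K : Set (EuclideanSpace ℝ (Fin n))) (α L : ℝ),
      0 < n → IsSymmConvexBody K → volume K = 1 → 0 < α → IsTwoConvex K α →
      IsIsotropic K L →
      Metric.closedBall (0 : EuclideanSpace ℝ (Fin n))
        (c * Real.sqrt α * Real.sqrt n * L) ⊆ K := by
  refine ⟨1 / 2, by norm_num, fun n K α L hn hK hvol hα0 hα hiso y hy => ?_⟩
  by_contra hyK
  obtain ⟨f, u, hfK, hfy⟩ := geometric_hahn_banach_closed_point hK.2.1 hK.1.isClosed hyK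
  set θ := (InnerProductSpace.toDual ℝ (EuclideanSpace ℝ (Fin n))).symm f
  have hf : ∀ x, ⟪x, θ⟫ = f x := fun x => by
    rw [real_inner_comm]
    exact InnerProductSpace.toDual_symm_apply
  have hu : 0 < u := by simpa using hfK 0 (mem_of_mem_nhds hK.mem_nhds_zero)
  have hn' : (0 : ℝ) < n := Nat.cast_pos.2 hn
  have hmom := hα.setIntegral_inner_sq_le (θ := θ) hn hK hvol hα0 hu
    fun x hx => (hf x).trans_le (hfK x hx).le
  rw [hiso.2 θ, le_div_iff₀ (by positivity)] at hmom
  have hy' : ‖y‖ ≤ 1 / 2 * √α * √n * L := by simpa using hy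
  have huy : u < 1 / 2 * √α * √n * L * ‖θ‖ :=
    calc u < ⟪y, θ⟫ := (hf y).symm ▸ hfy
      _ ≤ ‖y‖ * ‖θ‖ := real_inner_le_norm y θ
      _ ≤ _ := by gcongr
  have hsq : u ^ 2 < (1 / 2 * √α * √n * L * ‖θ‖) ^ 2 := by gcongr
  have : (1 / 2 * √α * √n * L * ‖θ‖) ^ 2 = 1 / 4 * (L ^ 2 * ‖θ‖ ^ 2 * (n * α)) := by
    simp only [mul_pow, Real.sq_sqrt hα0.le, Real.sq_sqrt hn'.le]
    ring
  nlinarith [sq_pos_of_pos hu]
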